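/- The function g_Θ(a) := max_{0≤b≤a} { Θ(a,b) − Θ(b,b)₊/2 } on [0,1] is nonnegative, satisfies g_Θ(a) ≥ Θ(a,a)₊/2 for all a, g_Θ(1) = 0, and obeys the constraint Θ(a,b) ≤ g_Θ(a) + g_Θ(b) for all a,b ∈ [0,1]. Consequently J ≤ ∫_{|x|≤1} |x|^{−7} g_Θ(|x|) dx = 4π ∫₀¹ a^{−5} g_Θ(a) da. -/

import Mathlib

open MeasureTheory ENNReal Set Metric Filter Real Topology

noncomputable section

/-- Three-dimensional Euclidean space. -/
abbrev E3 := EuclideanSpace ℝ (Fin 3)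

/-- `Θ(a,b) = a³b³(1-a-b)`. -/
def Theta (a b : ℝ) : ℝ := a ^ 3 * b ^ 3 * (1 - a - b)

/-- `g_Θ(a) = max_{0 ≤ b ≤ a} { Θ(a,b) - Θ(b,b)₊/2 }`. -/
def gTheta (a : ℝ) : ℝ := sSup ((fun b => Theta a b - max (Theta b b) 0 / 2) '' Icc 0 a)

/-- `J = inf { ∫_{|x|≤1} |x|⁻⁷ f(|x|) dx : f ∈ C⁰([0,1],ℝ), Θ(a,b) ≤ f(a)+f(b) on [0,1]² }`,
the infimum being restricted to those `f` for which the integral makes sense. -/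
def JJ : ℝ :=
  sInf {I : ℝ | ∃ f : ℝ → ℝ, ContinuousOn f (Icc 0 1) ∧
    (∀ a b, a ∈ Icc (0:ℝ) 1 → b ∈ Icc (0:ℝ) 1 → Theta a b ≤ f a + f b) ∧
    IntegrableOn (fun z : E3 => ‖z‖ ^ (-7:ℝ) * f ‖z‖) (closedBall 0 1) volume ∧
    I = ∫ z in closedBall (0:E3) 1, ‖z‖ ^ (-7:ℝ) * f ‖z‖}

lemma Theta_cont : Continuous (fun p : ℝ × ℝ => Theta p.1 p.2) := by
  unfold Theta; fun_prop

lemma aux_cont : Continuous (fun p : ℝ × ℝ => Theta p.1 p.2 - max (Theta p.2 p.2) 0 / 2) := by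
  unfold Theta; fun_prop

lemma bdd (a : ℝ) :
    BddAbove ((fun b => Theta a b - max (Theta b b) 0 / 2) '' Icc 0 a) := by
  apply (isCompact_Icc.image _).bddAbove
  exact aux_cont.comp (Continuous.prodMk_right a)

lemma le_g {a b : ℝ} (hb : b ∈ Icc 0 a) :
    Theta a b - max (Theta b b) 0 / 2 ≤ gTheta a :=
  le_csSup (bdd a) (mem_image_of_mem _ hb)

lemma g_le {a C : ℝ} (ha : 0 ≤ a)
    (h : ∀ b ∈ Icc 0 a, Theta a b - max (Theta b b) 0 / 2 ≤ C) : gTheta a ≤ C := by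
  apply csSup_le ((nonempty_Icc.2 ha).image _)
  rintro _ ⟨b, hb, rfl⟩
  exact h b hb

lemma g_nonneg {a : ℝ} (ha : 0 ≤ a) : 0 ≤ gTheta a := by
  have := le_g (a := a) (b := 0) ⟨le_rfl, ha⟩
  simpa [Theta] using this

lemma g_ge_half {a : ℝ} (ha : 0 ≤ a) : max (Theta a a) 0 / 2 ≤ gTheta a := by
  rcases le_total (Theta a a) 0 with h | h
  · rw [max_eq_right h]; simpa using g_nonneg ha
  · have := le_g (a := a) (b := a) ⟨ha, le_rfl⟩
    rw [max_eq_left h] at *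
    linarith

lemma g_one : gTheta 1 = 0 := by
  apply le_antisymm _ (g_nonneg zero_le_one)
  apply g_le zero_le_one
  rintro b ⟨hb, -⟩
  have h1 : Theta 1 b ≤ 0 := by
    unfold Theta
    have : 0 ≤ b ^ 4 := by positivity
    nlinarith
  have := le_max_right (Theta b b) 0
  linarith

lemma Theta_comm (a b : ℝ) : Theta a b = Theta b a := by unfold Theta; ring

lemma g_adm_aux {a b : ℝ} (hb : 0 ≤ b) (hab : b ≤ a) : Theta a b ≤ gTheta a + gTheta b := by
  have h1 := le_g (a := a) (b := b) ⟨hb, hab⟩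
  have h2 := g_ge_half hb
  linarith

lemma g_adm {a b : ℝ} (ha : 0 ≤ a) (hb : 0 ≤ b) : Theta a b ≤ gTheta a + gTheta b := by
  rcases le_total b a with h | h
  · exact g_adm_aux hb h
  · rw [Theta_comm, add_comm]; exact g_adm_aux ha h

lemma g_le_pow {a : ℝ} (ha : 0 ≤ a) : gTheta a ≤ a ^ 6 := by
  apply g_le ha
  rintro b ⟨hb, hba⟩
  have h3 := le_max_right (Theta b b) 0
  have h1 : Theta a b ≤ a ^ 6 := by
    unfold Theta
    calc a ^ 3 * b ^ 3 * (1 - a - b) ≤ a ^ 3 * b ^ 3 * 1 := by gcongr; linarith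
      _ ≤ a ^ 3 * a ^ 3 * 1 := by gcongr
      _ = a ^ 6 := by ring
  linarith

lemma g_cont : ContinuousOn gTheta (Ici 0) := by
  have h : Continuous (fun a : ℝ => sSup ((fun t : ℝ =>
      Theta a (a * t) - max (Theta (a * t) (a * t)) 0 / 2) '' Icc (0:ℝ) 1)) := by
    apply isCompact_Icc.continuous_sSup
    unfold Theta
    simp only [Function.HasUncurry.uncurry]
    fun_prop
  apply h.continuousOn.congr
  intro a (ha : 0 ≤ a)
  unfold gTheta
  congr 1
  have : Icc (0:ℝ) a = (fun t => a * t) '' Icc (0:ℝ) 1 := by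
    rw [image_mul_left_Icc ha zero_le_one]
    simp
  rw [this, image_image]

lemma rad_eq (z : E3) (f : ℝ → ℝ) :
    (closedBall (0:E3) 1).indicator (fun z : E3 => ‖z‖ ^ (-7:ℝ) * f ‖z‖) z =
      (Iic (1:ℝ)).indicator (fun r : ℝ => r ^ (-7:ℝ) * f r) ‖z‖ := by
  by_cases h : ‖z‖ ≤ 1 <;> simp [indicator, h]

lemma rad_eq' (f : ℝ → ℝ) {y : ℝ} (hy : y ∈ Ioi (0:ℝ)) :
    y ^ (3 - 1) • (Iic (1:ℝ)).indicator (fun r : ℝ => r ^ (-7:ℝ) * f r) y =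
      (Iic (1:ℝ)).indicator (fun r : ℝ => r ^ (-5:ℝ) * f r) y := by
  have hy' : (0:ℝ) < y := hy
  by_cases h : y ≤ 1
  · simp only [indicator, mem_Iic, h, if_true, smul_eq_mul]
    rw [← mul_assoc, ← Real.rpow_natCast y, ← Real.rpow_add hy']
    norm_num
  · simp [indicator, h]

lemma g_intble : IntegrableOn (fun z : E3 => ‖z‖ ^ (-7:ℝ) * gTheta ‖z‖) (closedBall 0 1)
    volume := by
  rw [← integrable_indicator_iff measurableSet_closedBall]
  simp_rw [funext fun z => rad_eq z gTheta]
  rw [integrable_fun_norm_addHaar volume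
    (f := (Iic (1:ℝ)).indicator (fun r : ℝ => r ^ (-7:ℝ) * gTheta r))]
  rw [finrank_euclideanSpace_fin]
  rw [integrableOn_congr_fun (fun y hy => rad_eq' gTheta hy) measurableSet_Ioi]
  rw [integrableOn_indicator_iff measurableSet_Iic, Iic_inter_Ioi]
  have hm : AEStronglyMeasurable (fun r : ℝ => r ^ (-5:ℝ) * gTheta r)
      (volume.restrict (Ioc 0 1)) := by
    apply ContinuousOn.aestronglyMeasurable _ measurableSet_Ioc
    apply ContinuousOn.mul
    · intro x hx
      exact (Real.continuousAt_rpow_const x _ (Or.inl hx.1.ne')).continuousWithinAt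
    · exact g_cont.mono fun x hx => hx.1.le
  apply Integrable.mono' (g := fun _ => (1:ℝ)) (integrableOn_const (by simp)) hm
  filter_upwards [ae_restrict_mem measurableSet_Ioc] with x hx
  have h5 : 0 ≤ x ^ (-5:ℝ) := Real.rpow_nonneg hx.1.le _
  rw [Real.norm_of_nonneg (mul_nonneg h5 (g_nonneg hx.1.le))]
  calc x ^ (-5:ℝ) * gTheta x ≤ x ^ (-5:ℝ) * x ^ 6 := by
        gcongr; exact g_le_pow hx.1.le
    _ = x := by
        rw [← Real.rpow_natCast x, ← Real.rpow_add hx.1]; norm_num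
    _ ≤ 1 := hx.2

lemma rad_int : ∫ z in closedBall (0:E3) 1, ‖z‖ ^ (-7:ℝ) * gTheta ‖z‖ =
      4 * π * ∫ a in Ioc (0:ℝ) 1, a ^ (-5:ℝ) * gTheta a := by
  rw [← integral_indicator measurableSet_closedBall]
  simp_rw [rad_eq _ gTheta]
  rw [integral_fun_norm_addHaar volume
    ((Iic (1:ℝ)).indicator (fun r : ℝ => r ^ (-7:ℝ) * gTheta r))]
  rw [finrank_euclideanSpace_fin]
  rw [setIntegral_congr_fun measurableSet_Ioi (fun y hy => rad_eq' gTheta hy)]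
  rw [setIntegral_indicator measurableSet_Iic, Ioi_inter_Iic, Measure.real,
    EuclideanSpace.volume_ball_fin_three]
  have : (0:ℝ) ≤ π * 4 / 3 := by positivity
  simp only [ENNReal.ofReal_one, one_pow, one_mul, ENNReal.toReal_ofReal this, smul_eq_mul,
    nsmul_eq_mul]
  push_cast
  ring

lemma lower (f : ℝ → ℝ)
    (hf : ∀ a b, a ∈ Icc (0:ℝ) 1 → b ∈ Icc (0:ℝ) 1 → Theta a b ≤ f a + f b)
    {r : ℝ} (hr : r ∈ Icc (0:ℝ) 1) : -1 ≤ r ^ (-7:ℝ) * f r := by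
  rcases hr.1.eq_or_lt with h | h
  · rw [← h, Real.zero_rpow (by norm_num)]; norm_num
  · have h1 := hf r r hr hr
    have h7 : r ^ (-7:ℝ) * r ^ 7 = 1 := by
      rw [← Real.rpow_natCast r, ← Real.rpow_add h]; norm_num
    have hp : 0 < r ^ (-7:ℝ) := Real.rpow_pos_of_pos h _
    have h2 : - r ^ 7 ≤ f r := by
      have h6 : 0 ≤ r ^ 6 := by positivity
      unfold Theta at h1
      nlinarith
    nlinarith

lemma JJ_le : JJ ≤ ∫ z in closedBall (0:E3) 1, ‖z‖ ^ (-7:ℝ) * gTheta ‖z‖ := by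
  apply csInf_le
  · refine ⟨∫ z in closedBall (0:E3) 1, (-1:ℝ), ?_⟩
    rintro I ⟨f, -, hf, hi, rfl⟩
    apply setIntegral_mono_on _ hi measurableSet_closedBall
    · intro z hz
      exact lower f hf ⟨norm_nonneg _, by simpa using hz⟩
    · exact integrableOn_const measure_closedBall_lt_top.ne
  · exact ⟨gTheta, g_cont.mono fun x hx => hx.1, fun a b ha hb => g_adm ha.1 hb.1, g_intble, rfl⟩

/-- Properties of `g_Θ` and the resulting upper bound on `J` (estimate (27) of the paper):
`g_Θ ≥ 0`, `g_Θ(a) ≥ Θ(a,a)₊/2`, `g_Θ(1) = 0`, `g_Θ` is admissible for `J`, and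
`J ≤ ∫_{|x|≤1} |x|⁻⁷ g_Θ(|x|) dx = 4π ∫₀¹ a⁻⁵ g_Θ(a) da`. -/
theorem gTheta_admissible_and_bound :
    (∀ a ∈ Icc (0:ℝ) 1, 0 ≤ gTheta a) ∧
    (∀ a ∈ Icc (0:ℝ) 1, max (Theta a a) 0 / 2 ≤ gTheta a) ∧
    gTheta 1 = 0 ∧
    (∀ a ∈ Icc (0:ℝ) 1, ∀ b ∈ Icc (0:ℝ) 1, Theta a b ≤ gTheta a + gTheta b) ∧
    JJ ≤ ∫ z in closedBall (0:E3) 1, ‖z‖ ^ (-7:ℝ) * gTheta ‖z‖ ∧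
    ∫ z in closedBall (0:E3) 1, ‖z‖ ^ (-7:ℝ) * gTheta ‖z‖ =
      4 * π * ∫ a in Ioc (0:ℝ) 1, a ^ (-5:ℝ) * gTheta a := by
  exact ⟨fun a ha => g_nonneg ha.1, fun a ha => g_ge_half ha.1, g_one,
    fun a ha b hb => g_adm ha.1 hb.1, JJ_le, rad_int⟩
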